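/- Let R = ℚ[t, t⁻¹] and consider the R-linear maps d₂ : R² → R³ whose matrix has columns c₁ = (−t⁴+t³−t+1, t⁴−t²+t, t²−t³−1) and c₂ = (−t⁴+t²−t, t³−t²+1, t⁴−t³+t−1), and d₁ : R³ → R given by d₁(p,q,r) = (t−1)(p+q+r). Then d₁ ∘ d₂ = 0, d₂ is injective, R/im(d₁) ≅ ℚ as a ℚ-vector space, and ker(d₁)/im(d₂) is isomorphic as an R-module to R/(Φ₁₅), where Φ₁₅ = t⁸−t⁷+t⁵−t⁴+t³−t+1 is the 15th cyclotomic polynomial; in particular this torsion module has dimension 8 over ℚ. -/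

import Mathlib

open LaurentPolynomial

/-- The ring `R = ℚ[t, t⁻¹]`. -/
abbrev RQ := LaurentPolynomial ℚ

/-- First column `c₁ = (−t⁴+t³−t+1, t⁴−t²+t, t²−t³−1)` of the differential `d₂`. -/
noncomputable def colOne : RQ × RQ × RQ :=
  (-T 4 + T 3 - T 1 + 1, T 4 - T 2 + T 1, T 2 - T 3 - 1)

/-- Second column `c₂ = (−t⁴+t²−t, t³−t²+1, t⁴−t³+t−1)` of the differential `d₂`. -/
noncomputable def colTwo : RQ × RQ × RQ :=
  (-T 4 + T 2 - T 1, T 3 - T 2 + 1, T 4 - T 3 + T 1 - 1)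

/-- `d₂ : R² → R³`, `(u, v) ↦ u·c₁ + v·c₂`. -/
noncomputable def dtwo : RQ × RQ →ₗ[RQ] RQ × RQ × RQ :=
  LinearMap.coprod
    (LinearMap.toSpanSingleton RQ (RQ × RQ × RQ) colOne)
    (LinearMap.toSpanSingleton RQ (RQ × RQ × RQ) colTwo)

/-- `d₁ : R³ → R`, `(p, q, r) ↦ (t−1)(p+q+r)`. -/
noncomputable def done : RQ × RQ × RQ →ₗ[RQ] RQ :=
  LinearMap.coprod (LinearMap.toSpanSingleton RQ RQ (T 1 - 1))
    (LinearMap.coprod (LinearMap.toSpanSingleton RQ RQ (T 1 - 1))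
      (LinearMap.toSpanSingleton RQ RQ (T 1 - 1)))

open Polynomial in
theorem cyclotomic_fifteen_rat :
    cyclotomic 15 ℚ = X ^ 8 - X ^ 7 + X ^ 5 - X ^ 4 + X ^ 3 - X + 1 := by
  have h := cyclotomic_expand_eq_cyclotomic_mul (p := 5) (n := 3) (by norm_num) (by norm_num) ℚ
  have h3 : cyclotomic 3 ℚ ≠ 0 := cyclotomic_ne_zero 3 ℚ
  refine mul_right_cancel₀ h3 ?_
  have h15 : 3 * 5 = 15 := by norm_num
  rw [h15] at h
  rw [← h, cyclotomic_three]
  simp only [map_add, map_pow, expand_X, map_one]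
  ring

theorem toLaurent_cyclotomic_fifteen :
    (Polynomial.cyclotomic 15 ℚ).toLaurent =
      (T 8 - T 7 + T 5 - T 4 + T 3 - T 1 + 1 : RQ) := by
  simp [cyclotomic_fifteen_rat]

/-- Inverting `X` does not change `K[X]/(f)` when `f` has nonzero constant term. -/
theorem LaurentPolynomial.finrank_quotient_span_toLaurent {K : Type*} [Field K]
    (f : Polynomial K) (hf : f.coeff 0 ≠ 0) :
    Module.finrank K (LaurentPolynomial K ⧸ Ideal.span {f.toLaurent}) = f.natDegree := by
  let I : Ideal (LaurentPolynomial K) := Ideal.span {f.toLaurent}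
  let F : Polynomial K →ₐ[K] LaurentPolynomial K ⧸ I :=
    (Ideal.Quotient.mkₐ K I).comp Polynomial.toLaurentAlg
  have hF : ∀ p, F p = Ideal.Quotient.mk I p.toLaurent := fun p => rfl
  have hinv : ∃ g : Polynomial K, F (g * Polynomial.X) = 1 := by
    refine ⟨-Polynomial.C (f.coeff 0)⁻¹ * f.divX, ?_⟩
    have h1 := f.divX_mul_X_add
    have h2 : Polynomial.C (f.coeff 0)⁻¹ * Polynomial.C (f.coeff 0) = 1 := by
      rw [← Polynomial.C_mul, inv_mul_cancel₀ hf, Polynomial.C_1]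
    rw [hF, ← map_one (Ideal.Quotient.mk I), Ideal.Quotient.eq, Ideal.mem_span_singleton,
      ← map_one Polynomial.toLaurent, ← map_sub]
    refine map_dvd Polynomial.toLaurent ⟨-Polynomial.C (f.coeff 0)⁻¹, ?_⟩
    linear_combination h2 - Polynomial.C (f.coeff 0)⁻¹ * h1
  have hsurj : Function.Surjective F := by
    intro y
    obtain ⟨x, rfl⟩ := Ideal.Quotient.mk_surjective y
    obtain ⟨n, p, hp⟩ := x.exists_T_pow
    obtain ⟨g, hg⟩ := hinv
    refine ⟨p * g ^ n, ?_⟩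
    have hX : F (Polynomial.X ^ n) = Ideal.Quotient.mk I (T n) := by
      rw [hF, Polynomial.toLaurent_X_pow]
    rw [map_mul, hF p, hp, map_mul, ← hX, mul_assoc, ← map_mul, mul_comm (Polynomial.X ^ n),
      ← mul_pow, map_pow, hg, one_pow, mul_one]
  have hker : RingHom.ker F = Ideal.span {f} := by
    ext p
    rw [RingHom.mem_ker, hF, Ideal.Quotient.eq_zero_iff_mem, Ideal.mem_span_singleton,
      Ideal.mem_span_singleton]
    refine ⟨?_, fun h => map_dvd Polynomial.toLaurent h⟩
    rintro ⟨h, hh⟩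
    obtain ⟨n, g, hg⟩ := h.exists_T_pow
    have key : Polynomial.X ^ n * p = f * g := by
      apply Polynomial.toLaurent_injective
      rw [map_mul, map_mul, Polynomial.toLaurent_X_pow, hh, hg]
      ring
    have hcop : IsCoprime f (Polynomial.X ^ n) := by
      apply IsCoprime.pow_right
      apply IsCoprime.symm
      rw [Polynomial.irreducible_X.coprime_iff_not_dvd, Polynomial.X_dvd_iff]
      exact hf
    exact hcop.dvd_of_dvd_mul_left ⟨g, key⟩
  have e := (Ideal.quotientEquivAlgOfEq K hker).symm.trans
    (Ideal.quotientKerAlgEquivOfSurjective hsurj)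
  exact e.toLinearEquiv.finrank_eq.symm.trans finrank_quotient_span_eq_natDegree

theorem dtwo_apply (u v : RQ) : dtwo (u, v) = u • colOne + v • colTwo := by
  simp [dtwo]

theorem done_apply (p q r : RQ) : done (p, q, r) = (T 1 - 1) * (p + q + r) := by
  simp [done]
  ring

theorem T_one_sub_one_ne_zero : (T 1 - 1 : RQ) ≠ 0 := by
  have h : (T 1 - 1 : RQ) = (Polynomial.X - Polynomial.C 1 : Polynomial ℚ).toLaurent := by simp
  rw [h, Ne, Polynomial.toLaurent_eq_zero]
  exact Polynomial.X_sub_C_ne_zero 1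

theorem mem_ker_done (p q r : RQ) : (p, q, r) ∈ LinearMap.ker done ↔ p + q + r = 0 := by
  rw [LinearMap.mem_ker, done_apply, mul_eq_zero, or_iff_right T_one_sub_one_ne_zero]

theorem dtwo_apply_eq (u v : RQ) :
    dtwo (u, v) =
      (u * (-T 1 ^ 4 + T 1 ^ 3 - T 1 + 1) + v * (-T 1 ^ 4 + T 1 ^ 2 - T 1),
        u * (T 1 ^ 4 - T 1 ^ 2 + T 1) + v * (T 1 ^ 3 - T 1 ^ 2 + 1),
        u * (T 1 ^ 2 - T 1 ^ 3 - 1) + v * (T 1 ^ 4 - T 1 ^ 3 + T 1 - 1)) := by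
  rw [dtwo_apply]
  simp [colOne, colTwo, T_pow]

theorem cyclotomic_fifteen_eq_T_one :
    (T 8 - T 7 + T 5 - T 4 + T 3 - T 1 + 1 : RQ) =
      T 1 ^ 8 - T 1 ^ 7 + T 1 ^ 5 - T 1 ^ 4 + T 1 ^ 3 - T 1 + 1 := by
  simp [T_pow]

theorem range_done : LinearMap.range done = Ideal.span {(T 1 - 1 : RQ)} := by
  ext x
  rw [LinearMap.mem_range, Ideal.mem_span_singleton]
  constructor
  · rintro ⟨⟨p, q, r⟩, rfl⟩
    exact ⟨_, done_apply p q r⟩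
  · rintro ⟨c, rfl⟩
    exact ⟨(c, 0, 0), by simp [done_apply]⟩

/-- The functional `(p, q, r) ↦ (t⁴−t³+t−1)q − (t³−t²+1)r`, which vanishes on `c₂` and sends `c₁`
to `Φ₁₅`. -/
noncomputable def detColTwo : RQ × RQ × RQ →ₗ[RQ] RQ :=
  LinearMap.coprod 0
    (LinearMap.coprod (LinearMap.toSpanSingleton RQ RQ (T 1 ^ 4 - T 1 ^ 3 + T 1 - 1))
      (LinearMap.toSpanSingleton RQ RQ (-(T 1 ^ 3 - T 1 ^ 2 + 1))))

theorem detColTwo_apply (p q r : RQ) :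
    detColTwo (p, q, r) =
      (T 1 ^ 4 - T 1 ^ 3 + T 1 - 1) * q - (T 1 ^ 3 - T 1 ^ 2 + 1) * r := by
  simp only [detColTwo, LinearMap.coprod_apply, LinearMap.zero_apply,
    LinearMap.toSpanSingleton_apply, smul_eq_mul]
  ring

theorem detColTwo_dtwo (u v : RQ) :
    detColTwo (dtwo (u, v)) = (T 8 - T 7 + T 5 - T 4 + T 3 - T 1 + 1 : RQ) * u := by
  rw [dtwo_apply_eq, detColTwo_apply, cyclotomic_fifteen_eq_T_one]
  ring

theorem mem_range_dtwo_iff (x : RQ × RQ × RQ) (hx : x ∈ LinearMap.ker done) :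
    x ∈ LinearMap.range dtwo ↔
      (T 8 - T 7 + T 5 - T 4 + T 3 - T 1 + 1 : RQ) ∣ detColTwo x := by
  constructor
  · rintro ⟨⟨u, v⟩, rfl⟩
    exact ⟨u, detColTwo_dtwo u v⟩
  · obtain ⟨p, q, r⟩ := x
    rintro ⟨u, hu⟩
    rw [mem_ker_done] at hx
    rw [detColTwo_apply, cyclotomic_fifteen_eq_T_one] at hu
    let v : RQ := T 1 * (q - u * (T 1 ^ 4 - T 1 ^ 2 + T 1)) - (r - u * (T 1 ^ 2 - T 1 ^ 3 - 1))
    have hq : u * (T 1 ^ 4 - T 1 ^ 2 + T 1) + v * (T 1 ^ 3 - T 1 ^ 2 + 1) = q := by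
      linear_combination hu
    have hr : u * (T 1 ^ 2 - T 1 ^ 3 - 1) + v * (T 1 ^ 4 - T 1 ^ 3 + T 1 - 1) = r := by
      linear_combination T 1 * hu
    refine ⟨(u, v), ?_⟩
    rw [dtwo_apply_eq, Prod.mk.injEq, Prod.mk.injEq]
    exact ⟨by linear_combination -hq - hr - hx, hq, hr⟩

theorem ker_dtwo : LinearMap.ker dtwo = ⊥ := by
  rw [LinearMap.ker_eq_bot']
  rintro ⟨u, v⟩ h
  have hu : u = 0 := by
    have h1 := detColTwo_dtwo u v
    rw [h, map_zero, ← toLaurent_cyclotomic_fifteen, eq_comm, mul_eq_zero,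
      Polynomial.toLaurent_eq_zero] at h1
    exact h1.resolve_left (Polynomial.cyclotomic_ne_zero 15 ℚ)
  subst hu
  rw [dtwo_apply_eq, Prod.mk_eq_zero, Prod.mk_eq_zero] at h
  obtain ⟨-, h2, h3⟩ := h
  rw [Prod.mk_eq_zero]
  exact ⟨rfl, by linear_combination T 1 * h2 - h3⟩

theorem nonempty_homology_equiv :
    Nonempty ((LinearMap.ker done ⧸
        (LinearMap.range dtwo).comap (LinearMap.ker done).subtype) ≃ₗ[RQ]
      RQ ⧸ Ideal.span {(T 8 - T 7 + T 5 - T 4 + T 3 - T 1 + 1 : RQ)}) := by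
  let I : Ideal RQ := Ideal.span {(T 8 - T 7 + T 5 - T 4 + T 3 - T 1 + 1 : RQ)}
  let g : LinearMap.ker done →ₗ[RQ] RQ ⧸ I :=
    (Submodule.mkQ I).comp (detColTwo.comp (LinearMap.ker done).subtype)
  have hsurj : Function.Surjective g := by
    intro y
    obtain ⟨w, rfl⟩ := Submodule.mkQ_surjective I y
    refine ⟨⟨(w + T 1 * w, -w, -(T 1 * w)), (mem_ker_done _ _ _).2 (by ring)⟩, ?_⟩
    change Submodule.mkQ I (detColTwo (w + T 1 * w, -w, -(T 1 * w))) = _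
    rw [detColTwo_apply]
    congr 1
    ring
  have hker : LinearMap.ker g = (LinearMap.range dtwo).comap (LinearMap.ker done).subtype := by
    ext x
    rw [Submodule.mem_comap, Submodule.subtype_apply, mem_range_dtwo_iff x x.2,
      LinearMap.mem_ker, ← Ideal.mem_span_singleton]
    exact Submodule.Quotient.mk_eq_zero I
  exact ⟨(Submodule.quotEquivOfEq _ _ hker.symm).trans (g.quotKerEquivOfSurjective hsurj)⟩

theorem nonempty_quotient_range_done_equiv :
    Nonempty ((RQ ⧸ LinearMap.range done) ≃ₗ[ℚ] ℚ) := by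
  have h := LaurentPolynomial.finrank_quotient_span_toLaurent
    (Polynomial.X - Polynomial.C 1 : Polynomial ℚ) (by simp)
  rw [Polynomial.natDegree_X_sub_C, map_sub, Polynomial.toLaurent_X, Polynomial.C_1, map_one] at h
  rw [range_done]
  have : Module.Finite ℚ (RQ ⧸ Ideal.span {(T 1 - 1 : RQ)}) :=
    Module.finite_of_finrank_pos (by rw [h]; exact one_pos)
  exact FiniteDimensional.nonempty_linearEquiv_of_finrank_eq (by rw [h, Module.finrank_self])

theorem finrank_quotient_cyclotomic_fifteen :
    Module.finrank ℚ
      (RQ ⧸ Ideal.span {(T 8 - T 7 + T 5 - T 4 + T 3 - T 1 + 1 : RQ)}) = 8 := by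
  rw [← toLaurent_cyclotomic_fifteen, LaurentPolynomial.finrank_quotient_span_toLaurent,
    Polynomial.natDegree_cyclotomic]
  · decide
  · rw [Polynomial.cyclotomic_coeff_zero ℚ (by norm_num)]
    exact one_ne_zero

/-- `d₁ ∘ d₂ = 0`, `d₂` is injective, `R/im(d₁) ≅ ℚ` as a `ℚ`-vector space, and
`ker(d₁)/im(d₂) ≅ R/(Φ₁₅)` as `R`-modules, where `Φ₁₅ = t⁸−t⁷+t⁵−t⁴+t³−t+1` is the 15th
cyclotomic polynomial; this torsion module has dimension 8 over `ℚ`. -/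
theorem milnor_fiber_complex_G22 :
    (∀ u v : RQ, dtwo (u, v) = u • colOne + v • colTwo) ∧
    (∀ p q r : RQ, done (p, q, r) = (T 1 - 1) * (p + q + r)) ∧
    done.comp dtwo = 0 ∧
    LinearMap.ker dtwo = ⊥ ∧
    Nonempty ((RQ ⧸ LinearMap.range done) ≃ₗ[ℚ] ℚ) ∧
    ((Polynomial.cyclotomic 15 ℚ).toLaurent =
      (T 8 - T 7 + T 5 - T 4 + T 3 - T 1 + 1 : RQ)) ∧
    Nonempty ((LinearMap.ker done ⧸
        (LinearMap.range dtwo).comap (LinearMap.ker done).subtype) ≃ₗ[RQ]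
      RQ ⧸ Ideal.span {(T 8 - T 7 + T 5 - T 4 + T 3 - T 1 + 1 : RQ)}) ∧
    Module.finrank ℚ (LinearMap.ker done ⧸
        (LinearMap.range dtwo).comap (LinearMap.ker done).subtype) = 8 := by
  obtain ⟨e⟩ := nonempty_homology_equiv
  refine ⟨dtwo_apply, done_apply, ?_, ker_dtwo, nonempty_quotient_range_done_equiv,
    toLaurent_cyclotomic_fifteen, ⟨e⟩, ?_⟩
  · refine LinearMap.ext fun ⟨u, v⟩ => ?_
    rw [LinearMap.comp_apply, dtwo_apply_eq, done_apply, LinearMap.zero_apply]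
    ring
  · exact (e.restrictScalars ℚ).finrank_eq.trans finrank_quotient_cyclotomic_fifteen
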